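/- arXiv:2409.15192 — 4 statements merged into one kernel-verified Lean document; each statement's English description precedes it below -/
import Mathlib

section
/- Let k ≥ 1 and a ≥ b be natural numbers. Consider all pairs of functions x, y : Fin k → ℕ satisfying (i) ∑ i, x i ≥ a, (ii) ∑ i, y i ≥ b, and (iii) for all i, x i ≤ y i + 1 and y i ≤ x i + 1. Then the minimum over all such pairs of max_{i ∈ Fin k} (x i + y i) equals max(⌈(a+b)/k⌉, 2·⌈a/k⌉ − 1), where subtraction is truncated natural-number subtraction. -/
theorem sum_indicator_val_lt (k p : ℕ) (hp : p ≤ k) :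
    ∑ i : Fin k, (if i.val < p then 1 else 0) = p := by
  rw [Finset.sum_boole, Fin.card_filter_val_lt]
  simp [hp]

/-- Every vehicle can be given exactly `m` turns as soon
as `a + b ≤ k * m` and `a ≤ k * c` for some `c` with `2 * c ≤ m + 1`. -/
theorem exists_alternating_counts (k a b m : ℕ) (hab : b ≤ a)
    (hsum : a + b ≤ k * m) (hx : ∃ c, a ≤ k * c ∧ 2 * c ≤ m + 1) :
    ∃ x y : Fin k → ℕ, a ≤ ∑ i, x i ∧ b ≤ ∑ i, y i ∧
      (∀ i, x i ≤ y i + 1 ∧ y i ≤ x i + 1) ∧ ∀ i, x i + y i = m := by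
  obtain ⟨c, hac, hcm⟩ := hx
  obtain ⟨t, rfl | rfl⟩ := m.even_or_odd'
  · have hct : k * c ≤ k * t := Nat.mul_le_mul_left k (by omega)
    refine ⟨fun _ => t, fun _ => t, ?_, ?_, by simp, fun _ => (two_mul t).symm⟩ <;>
      simp only [Finset.sum_const, Finset.card_univ, Fintype.card_fin, smul_eq_mul] <;> omega
  · have hct : k * c ≤ k * (t + 1) := Nat.mul_le_mul_left k (by omega)
    have hsum' : k * (2 * t + 1) = 2 * (k * t) + k := by ring
    rw [mul_add_one] at hct
    have hp := sum_indicator_val_lt k (a - k * t) (by omega)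
    have hq : ∑ i : Fin k, (if i.val < a - k * t then 0 else 1) +
        ∑ i : Fin k, (if i.val < a - k * t then 1 else 0) = k := by
      rw [← Finset.sum_add_distrib, Finset.sum_congr rfl (g := fun _ => 1)]
      · simp
      · intro i _
        split_ifs <;> rfl
    rw [hp] at hq
    refine ⟨fun i => t + if i.val < a - k * t then 1 else 0,
      fun i => t + if i.val < a - k * t then 0 else 1, ?_, ?_, ?_, ?_⟩
    · simp only [Finset.sum_add_distrib, Finset.sum_const, Finset.card_univ, Fintype.card_fin,
        smul_eq_mul, hp]
      omega
    · simp only [Finset.sum_add_distrib, Finset.sum_const, Finset.card_univ, Fintype.card_fin,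
        smul_eq_mul]
      omega
    · intro i
      dsimp only
      split_ifs <;> omega
    · intro i
      dsimp only
      split_ifs <;> omega

theorem le_mul_ceilDiv (n k : ℕ) (hk : 1 ≤ k) : n ≤ k * ((n + k - 1) / k) := by
  have := Nat.lt_mul_div_succ (n + k - 1) hk
  rw [mul_add_one] at this
  omega

theorem ceilDiv_le_of_le_mul (n k m : ℕ) (hk : 1 ≤ k) (h : n ≤ k * m) :
    (n + k - 1) / k ≤ m := by
  rw [← Nat.lt_succ_iff, Nat.div_lt_iff_lt_mul hk, Nat.succ_mul, mul_comm m k]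
  omega

theorem le_mul_of_sum_le {k n m : ℕ} {f : Fin k → ℕ} (hn : n ≤ ∑ i, f i) (hf : ∀ i, f i ≤ m) :
    n ≤ k * m :=
  hn.trans <| (Finset.sum_le_card_nsmul Finset.univ f m fun i _ => hf i).trans_eq (by simp)


/-- Combinatorial core of the subroute-combination lemma: with `k ≥ 1` vehicles,
`x i` ascending and `y i` descending subroutes per vehicle (alternating, hence
`|x i - y i| ≤ 1`), totals at least `a` resp. `b` with `a ≥ b`, the minimum of
the maximum number `x i + y i` of turns per vehicle equals
`max ⌈(a+b)/k⌉ (2⌈a/k⌉ - 1)`. -/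
theorem minTurn_subroute_combination (k a b : ℕ) (hk : 1 ≤ k) (hab : b ≤ a) :
    IsLeast {m : ℕ | ∃ x y : Fin k → ℕ,
        a ≤ ∑ i, x i ∧ b ≤ ∑ i, y i ∧
        (∀ i, x i ≤ y i + 1 ∧ y i ≤ x i + 1) ∧
        m = Finset.univ.sup (fun i => x i + y i)}
      (max ((a + b + k - 1) / k) (2 * ((a + k - 1) / k) - 1)) := by
  constructor
  · have hA := le_mul_ceilDiv a k hk
    have hS := le_mul_ceilDiv (a + b) k hk
    set A := (a + k - 1) / k
    set S := (a + b + k - 1) / k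
    obtain ⟨x, y, hx, hy, hxy, hm⟩ := exists_alternating_counts k a b (max S (2 * A - 1)) hab
      (hS.trans (Nat.mul_le_mul_left k (le_max_left _ _))) ⟨A, hA, by omega⟩
    refine ⟨x, y, hx, hy, hxy, ?_⟩
    have : Nonempty (Fin k) := ⟨⟨0, hk⟩⟩
    simp only [hm]
    exact (Finset.sup_const Finset.univ_nonempty _).symm
  · rintro m ⟨x, y, hx, hy, hxy, rfl⟩
    set m := Finset.univ.sup (fun i => x i + y i) with hm
    have hle : ∀ i, x i + y i ≤ m := fun i =>
      Finset.le_sup (f := fun i => x i + y i) (Finset.mem_univ i)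
    have hS : (a + b + k - 1) / k ≤ m := ceilDiv_le_of_le_mul _ _ _ hk <|
      le_mul_of_sum_le (f := fun i => x i + y i)
        (by rw [Finset.sum_add_distrib]; exact add_le_add hx hy) hle
    have hA : (a + k - 1) / k ≤ (m + 1) / 2 := ceilDiv_le_of_le_mul _ _ _ hk <|
      le_mul_of_sum_le hx fun i => by
        have := hle i
        have := hxy i
        omega
    omega
end

section
/- Let c ≥ 1 be a natural number and let (o_i, d_i), for i in a finite index type ι, be a family of interval requests with o_i < d_i natural numbers. Let χ be the maximum cardinality of a subset of ι whose members pairwise overlap. Then the minimum natural number m for which there exists a function f : ι → Fin m such that for every part j ∈ Fin m and every natural number x, the load at x of the subfamily f⁻¹(j) is at most c, equals ⌈χ/c⌉. -/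
/-- Greedy assignment: if at most `m * c` of the intervals `[o i, d i)`, `i ∈ S`, contain any
given point, then `S` splits into `m` parts at most `c` of whose members contain any given
point. -/
theorem exists_partition_load_le {ι : Type*} (o d : ι → ℕ) (m c : ℕ) (S : Finset ι)
    (hS : ∀ x, (S.filter fun i => o i ≤ x ∧ x < d i).card ≤ m * c) (hod : ∀ i ∈ S, o i < d i) :
    ∃ f : ι → ℕ, (∀ i ∈ S, f i < m) ∧
      ∀ j x, (S.filter fun i => f i = j ∧ o i ≤ x ∧ x < d i).card ≤ c := by
  classical
  induction S using Finset.induction_on_max_value o with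
  | empty => exact ⟨fun _ => 0, by simp, by simp⟩
  | insert a s ha hmax ih =>
    obtain ⟨f, hfm, hfc⟩ := ih
      (fun x => (Finset.card_le_card (Finset.filter_subset_filter _ (Finset.subset_insert a s))).trans
        (hS x)) (fun i hi => hod i (Finset.mem_insert_of_mem hi))
    have hlt : (s.filter fun i => o i ≤ o a ∧ o a < d i).card < (Finset.range m).card * c := by
      have h := hS (o a)
      rw [Finset.filter_insert, if_pos ⟨le_rfl, hod a (Finset.mem_insert_self a s)⟩,
        Finset.card_insert_of_notMem (by simp [ha])] at h
      simpa using h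
    obtain ⟨k, hk, hkc⟩ := Finset.exists_card_fiber_lt_of_card_lt_mul (f := f) hlt
    have hne : ∀ i ∈ s, i ≠ a := fun i hi h => ha (h ▸ hi)
    refine ⟨Function.update f a k, fun i hi => ?_, fun j x => ?_⟩
    · rcases Finset.mem_insert.1 hi with rfl | hi
      · simpa using hk
      · simpa [hne i hi] using hfm i hi
    · have hupd : (s.filter fun i => Function.update f a k i = j ∧ o i ≤ x ∧ x < d i) =
          s.filter fun i => f i = j ∧ o i ≤ x ∧ x < d i :=
        Finset.filter_congr fun i hi => by rw [Function.update_of_ne (hne i hi)]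
      rw [Finset.filter_insert, hupd, Function.update_self]
      split_ifs with h
      · obtain ⟨rfl, hax, hxa⟩ := h
        refine (Finset.card_insert_le _ _).trans (Nat.succ_le_of_lt (lt_of_le_of_lt ?_ hkc))
        refine Finset.card_le_card fun i hi => ?_
        simp only [Finset.mem_filter] at hi ⊢
        exact ⟨⟨hi.1, hmax i hi.1, by omega⟩, hi.2.1⟩
      · exact hfc j x

/-- Pairwise overlapping intervals have a common point. -/
theorem exists_mem_of_pairwise_overlap {ι : Type*} (o d : ι → ℕ) (S : Finset ι)
    (hS : ∀ i ∈ S, ∀ j ∈ S, max (o i) (o j) < min (d i) (d j)) :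
    ∃ x, ∀ i ∈ S, o i ≤ x ∧ x < d i := by
  rcases S.eq_empty_or_nonempty with rfl | hne
  · simp
  · obtain ⟨a, ha, hmax⟩ := S.exists_max_image o hne
    exact ⟨o a, fun i hi => ⟨hmax i hi, by have := hS i hi a ha; omega⟩⟩


/-- If `χ` is the maximum number of pairwise overlapping interval requests, then the
minimum number `m` of parts into which the requests can be split so that each part has
load at most `c` everywhere is `⌈χ/c⌉`. -/
theorem min_subroutes_eq_ceil_div {ι : Type*} [Fintype ι]
    (c : ℕ) (hc : 1 ≤ c) (o d : ι → ℕ) (hod : ∀ i, o i < d i)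
    (χ : ℕ)
    (hχ : IsGreatest {n : ℕ | ∃ S : Finset ι, S.card = n ∧
        ∀ i ∈ S, ∀ j ∈ S, max (o i) (o j) < min (d i) (d j)} χ) :
    IsLeast {m : ℕ | ∃ f : ι → Fin m, ∀ j : Fin m, ∀ x : ℕ,
        (Finset.univ.filter (fun i => f i = j ∧ o i ≤ x ∧ x < d i)).card ≤ c}
      ((χ + c - 1) / c) := by
  obtain ⟨⟨S, hScard, hS⟩, hub⟩ := hχ
  constructor
  · have hχm : χ ≤ (χ + c - 1) / c * c := by
      have := Nat.lt_div_mul_add (a := χ + c - 1) hc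
      omega
    obtain ⟨f, hfm, hfc⟩ := exists_partition_load_le o d ((χ + c - 1) / c) c Finset.univ
      (fun x => (hub ⟨_, rfl, fun i hi j hj => by
        simp only [Finset.mem_filter] at hi hj
        omega⟩).trans hχm) (fun i _ => hod i)
    refine ⟨fun i => ⟨f i, hfm i (Finset.mem_univ i)⟩, fun j x => ?_⟩
    simpa only [Fin.ext_iff] using hfc j x
  · rintro m ⟨f, hf⟩
    obtain ⟨x, hx⟩ := exists_mem_of_pairwise_overlap o d S hS
    have hle : S.card ≤ c * (Finset.univ : Finset (Fin m)).card :=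
      Finset.card_le_mul_card_image_of_maps_to (f := f) (fun i _ => Finset.mem_univ _) c
        fun j _ => (Finset.card_le_card fun i hi => by
          simp only [Finset.mem_filter] at hi
          simpa using ⟨hi.2, hx i hi.1⟩).trans (hf j x)
    rw [hScard, Finset.card_univ, Fintype.card_fin] at hle
    rw [← Nat.lt_succ_iff, Nat.div_lt_iff_lt_mul hc, Nat.succ_mul, mul_comm m]
    omega
end

section
/- Let (o_i, d_i), for i in a finite index type ι, be a family of interval requests with o_i < d_i natural numbers, and let G be the simple graph on ι in which distinct i and j are adjacent if and only if the requests i and j overlap. Then the chromatic number of G equals the maximum over natural numbers x of the load of the family at x. -/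
/-- Greedy colouring: if the vertices are ordered by a ranking `f` and every vertex has fewer
than `k` neighbours of rank at most its own, then the graph is `k`-colourable. -/
theorem SimpleGraph.colorable_of_card_lower_neighbors_lt {V α : Type*} [Finite V] [LinearOrder α]
    (G : SimpleGraph V) (f : V → α) (k : ℕ)
    (h : ∀ (a : V) (s : Finset V), (∀ i ∈ s, G.Adj a i ∧ f i ≤ f a) → s.card < k) :
    G.Colorable k := by
  classical
  have := Fintype.ofFinite V
  have key (s : Finset V) : ∃ c : V → ℕ, (∀ i ∈ s, c i < k) ∧
      ∀ i ∈ s, ∀ j ∈ s, G.Adj i j → c i ≠ c j := by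
    induction s using Finset.induction_on_max_value f with
    | empty => exact ⟨fun _ => 0, by simp⟩
    | insert a s ha hmax ih =>
      obtain ⟨c, hck, hc⟩ := ih
      have hN : ((s.filter (G.Adj a)).image c).card < (Finset.range k).card := by
        rw [Finset.card_range]
        refine Finset.card_image_le.trans_lt (h a _ fun i hi => ?_)
        rw [Finset.mem_filter] at hi
        exact ⟨hi.2, hmax i hi.1⟩
      obtain ⟨m, hmk, hm⟩ := Finset.exists_mem_notMem_of_card_lt_card hN
      have hfresh (j : V) (hj : j ∈ s) (haj : G.Adj a j) : m ≠ c j := fun he =>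
        hm (he ▸ Finset.mem_image_of_mem c (Finset.mem_filter.2 ⟨hj, haj⟩))
      have hne (j : V) (hj : j ∈ s) : j ≠ a := fun he => ha (he ▸ hj)
      refine ⟨Function.update c a m, fun i hi => ?_, fun i hi j hj hij => ?_⟩
      · obtain rfl | hi := Finset.mem_insert.1 hi
        · simpa using hmk
        · simpa [hne i hi] using hck i hi
      · obtain rfl | his := Finset.mem_insert.1 hi <;> obtain rfl | hjs := Finset.mem_insert.1 hj
        · exact (G.irrefl hij).elim
        · simpa [hne j hjs] using hfresh j hjs hij
        · simpa [hne i his] using (hfresh i his hij.symm).symm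
        · simpa [hne i his, hne j hjs] using hc i his j hjs hij
  obtain ⟨c, hck, hc⟩ := key Finset.univ
  exact ⟨SimpleGraph.Coloring.mk (fun i => (⟨c i, hck i (Finset.mem_univ i)⟩ : Fin k))
    fun {i j} hij he => hc i (Finset.mem_univ i) j (Finset.mem_univ j) hij (congrArg Fin.val he)⟩

/-- The chromatic number of the conflict graph of a family of interval requests
equals the maximum load at a point. -/
theorem chromaticNumber_conflict_graph_eq_max_load {ι : Type*} [Fintype ι]
    (o d : ι → ℕ) (hod : ∀ i, o i < d i)
    (G : SimpleGraph ι)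
    (hG : ∀ i j, G.Adj i j ↔ i ≠ j ∧ max (o i) (o j) < min (d i) (d j)) :
    G.chromaticNumber =
      ((⨆ x : ℕ, (Finset.univ.filter (fun i => o i ≤ x ∧ x < d i)).card : ℕ) : ℕ∞) := by
  classical
  have hbdd : BddAbove (Set.range fun x : ℕ =>
      (Finset.univ.filter (fun i => o i ≤ x ∧ x < d i)).card) :=
    ⟨Fintype.card ι, by rintro _ ⟨x, rfl⟩; exact Finset.card_le_univ _⟩
  apply le_antisymm
  · refine SimpleGraph.Colorable.chromaticNumber_le
      (G.colorable_of_card_lower_neighbors_lt o _ fun a s hs => ?_)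
    have ha : a ∉ s := fun ha => G.irrefl (hs a ha).1
    have hsub : insert a s ⊆ Finset.univ.filter (fun i => o i ≤ o a ∧ o a < d i) := by
      intro i hi
      rw [Finset.mem_filter]
      refine ⟨Finset.mem_univ i, ?_⟩
      obtain rfl | hi := Finset.mem_insert.1 hi
      · exact ⟨le_rfl, hod i⟩
      · have := ((hG a i).1 (hs i hi).1).2
        have := (hs i hi).2
        omega
    calc s.card < (insert a s).card := by rw [Finset.card_insert_of_notMem ha]; omega
      _ ≤ _ := Finset.card_le_card hsub
      _ ≤ _ := le_ciSup hbdd (o a)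
  · obtain ⟨x, hx⟩ := Nat.sSup_mem (Set.range_nonempty _) hbdd
    rw [iSup, ← hx]
    refine SimpleGraph.IsClique.card_le_chromaticNumber fun i hi j hj hij => (hG i j).2 ⟨hij, ?_⟩
    simp only [Finset.coe_filter, Finset.mem_univ, true_and, Set.mem_ofPred_eq] at hi hj
    omega
end

section
/- Let k ≥ 1 and c ≥ 1 be natural numbers, let (o_i, d_i) for i ∈ ι_A be a finite family of ascending interval requests and (o'_j, d'_j) for j ∈ ι_B a finite family of descending interval requests (both given as pairs of naturals with first component strictly less than second). Let χ_A (resp. χ_B) be the maximum over natural numbers x of the load of the ascending (resp. descending) family at x, and set a = ⌈χ_A/c⌉, b = ⌈χ_B/c⌉; assume a ≥ b. Define a feasible plan to be a tuple (x, y, f, g) where x, y : Fin k → ℕ satisfy x i ≤ y i + 1 and y i ≤ x i + 1 for all i, f assigns each ascending request to a pair (i, s) with i ∈ Fin k and s ∈ Fin (x i), g assigns each descending request to a pair (i, s) with i ∈ Fin k and s ∈ Fin (y i), and for every vehicle i, every slot, and every natural number x, the load at x of the requests assigned to that slot is at most c. Then the minimum over all feasible plans of max_{i ∈ Fin k} (x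 i + y i) equals max(⌈(a+b)/k⌉, 2·⌈a/k⌉ − 1), where subtraction is truncated natural-number subtraction. -/
/-- Greedy interval colouring: intervals `[o i, d i)` whose total load is at most `c * card T`
everywhere can be distributed over the slots `T` so that every slot has load at most `c`. -/
theorem exists_assignment_load_le {ι T : Type*} [Fintype ι] [Fintype T] (c : ℕ) (o d : ι → ℕ)
    (hod : ∀ i, o i < d i)
    (hload : ∀ t, Nat.card {i : ι // o i ≤ t ∧ t < d i} ≤ c * Fintype.card T) :
    ∃ f : ι → T, ∀ (s : T) (t : ℕ), Nat.card {j : ι // f j = s ∧ o j ≤ t ∧ t < d j} ≤ c := by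
  classical
  simp only [Nat.card_eq_fintype_card, Fintype.card_subtype] at hload ⊢
  rcases isEmpty_or_nonempty ι with hι | ⟨⟨i₀⟩⟩
  · exact ⟨hι.elim, fun s t => by simp⟩
  have hT : Nonempty T := by
    have h₁ := hload (o i₀)
    have h₂ : 0 < (Finset.univ.filter fun i => o i ≤ o i₀ ∧ o i₀ < d i).card :=
      Finset.card_pos.2 ⟨i₀, by simp [hod i₀]⟩
    exact Fintype.card_pos_iff.1 (Nat.pos_of_mul_pos_left (h₂.trans_le h₁))
  suffices H : ∀ S : Finset ι, ∃ f : ι → T, ∀ (s : T) (t : ℕ),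
      (S.filter fun j => f j = s ∧ o j ≤ t ∧ t < d j).card ≤ c from H Finset.univ
  intro S
  induction S using Finset.induction_on_max_value o with
  | empty => exact ⟨fun _ => hT.some, fun s t => by simp⟩
  | insert i S hi hmax ih =>
    obtain ⟨f, hf⟩ := ih
    have hlt : (S.filter fun j => o j ≤ o i ∧ o i < d j).card
        < (Finset.univ : Finset T).card * c := by
      rw [Finset.card_univ, mul_comm]
      refine lt_of_lt_of_le (Finset.card_lt_card ?_) (hload (o i))
      refine Finset.ssubset_iff_of_subset (fun j hj => ?_) |>.2 ⟨i, ?_, ?_⟩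
      · simpa using (Finset.mem_filter.1 hj).2
      · simp [hod i]
      · simp [hi]
    obtain ⟨s₀, -, hs₀⟩ := Finset.exists_card_fiber_lt_of_card_lt_mul (f := f) hlt
    refine ⟨Function.update f i s₀, fun s t => ?_⟩
    have hcongr : (S.filter fun j => Function.update f i s₀ j = s ∧ o j ≤ t ∧ t < d j)
        = S.filter fun j => f j = s ∧ o j ≤ t ∧ t < d j := by
      refine Finset.filter_congr fun j hj => ?_
      rw [Function.update_of_ne (ne_of_mem_of_not_mem hj hi)]
    rw [Finset.filter_insert, hcongr]
    split_ifs with h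
    · rw [Function.update_self] at h
      obtain ⟨rfl, hot, -⟩ := h
      refine (Finset.card_insert_le _ _).trans (Nat.succ_le_of_lt (lt_of_le_of_lt ?_ hs₀))
      refine Finset.card_le_card fun j hj => ?_
      simp only [Finset.mem_filter] at hj ⊢
      exact ⟨⟨hj.1, hmax j hj.1, hot.trans_lt hj.2.2.2⟩, hj.2.1⟩
    · exact hf s t

/-- If every slot in `T` has load at most `c`, then the total load is at most `c * card T`. -/
theorem load_le_mul_card {ι T : Type*} [Fintype ι] [Fintype T] (c : ℕ) (o d : ι → ℕ)
    (f : ι → T) (t : ℕ)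
    (hf : ∀ s, Nat.card {j : ι // f j = s ∧ o j ≤ t ∧ t < d j} ≤ c) :
    Nat.card {i : ι // o i ≤ t ∧ t < d i} ≤ c * Fintype.card T := by
  classical
  simp only [Nat.card_eq_fintype_card, Fintype.card_subtype] at hf ⊢
  refine (Finset.card_le_mul_card_image (f := f) _ c fun s _ => ?_).trans
    (Nat.mul_le_mul_left c (Finset.card_le_univ _))
  rw [Finset.filter_filter]
  simpa only [and_comm] using hf s

theorem load_le_iSup_load {ι : Type*} [Fintype ι] (o d : ι → ℕ) (t : ℕ) :
    Nat.card {i : ι // o i ≤ t ∧ t < d i} ≤ ⨆ x : ℕ, Nat.card {i : ι // o i ≤ x ∧ x < d i} :=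
  le_ciSup (f := fun x : ℕ => Nat.card {i : ι // o i ≤ x ∧ x < d i})
    ⟨Nat.card ι, by rintro _ ⟨x, rfl⟩; exact Finite.card_subtype_le _⟩ t

theorem Nat.add_sub_one_div_le_iff {p q n : ℕ} (hq : 1 ≤ q) :
    (p + q - 1) / q ≤ n ↔ p ≤ q * n := by
  rw [← Nat.lt_succ_iff, Nat.div_lt_iff_lt_mul hq, Nat.succ_mul, mul_comm n q]
  omega

/-- Numbers of ascending and descending subroutes for each of `k` vehicles making `M` turns. -/
theorem exists_turn_distribution {k a b M : ℕ} (hab : b ≤ a) (hsum : a + b ≤ k * M)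
    (hodd : 2 * ((a + k - 1) / k) - 1 ≤ M) (hk : 1 ≤ k) :
    ∃ x y : Fin k → ℕ, (∀ i, x i ≤ y i + 1 ∧ y i ≤ x i + 1) ∧ (∀ i, x i + y i = M) ∧
      a ≤ ∑ i, x i ∧ b ≤ ∑ i, y i := by
  have hp := (Nat.add_sub_one_div_le_iff (p := a) hk).1 le_rfl
  set p := (a + k - 1) / k
  rcases Nat.even_or_odd' M with ⟨q, rfl | rfl⟩
  · have hpq : k * p ≤ k * q := Nat.mul_le_mul_left k (by omega)
    refine ⟨fun _ => q, fun _ => q, fun _ => by simp, fun _ => (two_mul q).symm, ?_, ?_⟩ <;>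
      simp only [Finset.sum_const, Finset.card_univ, Fintype.card_fin, smul_eq_mul] <;> omega
  · have hpq : k * p ≤ k * (q + 1) := Nat.mul_le_mul_left k (by omega)
    rw [mul_add, mul_one] at hpq
    have hM : k * (2 * q + 1) = 2 * (k * q) + k := by ring
    obtain ⟨r, hr⟩ : ∃ r, r = a - k * q := ⟨_, rfl⟩
    have hcount : (Finset.univ.filter fun i : Fin k => i.val < r).card = r := by
      rw [Fin.card_filter_val_lt]
      omega
    have hx : ∑ i : Fin k, (q + if i.val < r then 1 else 0) = k * q + r := by
      rw [Finset.sum_add_distrib, Finset.sum_boole, hcount]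
      simp
    have htot : ∑ i : Fin k, (q + if i.val < r then 1 else 0)
        + ∑ i : Fin k, (q + if i.val < r then 0 else 1) = k * (2 * q + 1) := by
      rw [← Finset.sum_add_distrib, Finset.sum_congr rfl (g := fun _ => 2 * q + 1)]
      · simp
      · intro i _
        split_ifs <;> omega
    refine ⟨fun i => q + if i.val < r then 1 else 0, fun i => q + if i.val < r then 0 else 1,
      fun i => ?_, fun i => ?_, ?_, ?_⟩
    · dsimp only
      split_ifs <;> omega
    · dsimp only
      split_ifs <;> omega
    · dsimp only
      omega
    · dsimp only
      omega


/-- MinTurn without time windows, capacity-determined feasibility: the minimum over all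
feasible plans of the maximum number of turns per vehicle is
`max ⌈(a+b)/k⌉ (2⌈a/k⌉ - 1)`, where `a = ⌈χ_A/c⌉` and `b = ⌈χ_B/c⌉` are computed from
the maximum loads `χ_A`, `χ_B` of the ascending and descending request families. -/
theorem minTurn_capacity_value {ιA ιB : Type*} [Fintype ιA] [Fintype ιB]
    (k c : ℕ) (hk : 1 ≤ k) (hc : 1 ≤ c)
    (o d : ιA → ℕ) (hod : ∀ i, o i < d i)
    (o' d' : ιB → ℕ) (hod' : ∀ j, o' j < d' j)
    (χA χB a b : ℕ)
    (hχA : χA = ⨆ x : ℕ, Nat.card {i : ιA // o i ≤ x ∧ x < d i})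
    (hχB : χB = ⨆ x : ℕ, Nat.card {j : ιB // o' j ≤ x ∧ x < d' j})
    (ha : a = (χA + c - 1) / c) (hb : b = (χB + c - 1) / c) (hab : b ≤ a) :
    IsLeast {m : ℕ | ∃ (x y : Fin k → ℕ)
        (f : ιA → Σ i : Fin k, Fin (x i)) (g : ιB → Σ i : Fin k, Fin (y i)),
        (∀ i, x i ≤ y i + 1 ∧ y i ≤ x i + 1) ∧
        (∀ (i : Fin k) (s : Fin (x i)) (t : ℕ),
          Nat.card {j : ιA // f j = ⟨i, s⟩ ∧ o j ≤ t ∧ t < d j} ≤ c) ∧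
        (∀ (i : Fin k) (s : Fin (y i)) (t : ℕ),
          Nat.card {j : ιB // g j = ⟨i, s⟩ ∧ o' j ≤ t ∧ t < d' j} ≤ c) ∧
        m = Finset.univ.sup (fun i => x i + y i)}
      (max ((a + b + k - 1) / k) (2 * ((a + k - 1) / k) - 1)) := by
  have haχ : ∀ n, a ≤ n ↔ χA ≤ c * n := fun n => ha ▸ Nat.add_sub_one_div_le_iff hc
  have hbχ : ∀ n, b ≤ n ↔ χB ≤ c * n := fun n => hb ▸ Nat.add_sub_one_div_le_iff hc
  constructor
  · obtain ⟨x, y, hxy, hM, hx, hy⟩ := exists_turn_distribution hab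
      ((Nat.add_sub_one_div_le_iff hk).1 (le_max_left _ _))
      (le_max_right ((a + b + k - 1) / k) (2 * ((a + k - 1) / k) - 1)) hk
    obtain ⟨f, hf⟩ := exists_assignment_load_le (T := Σ i : Fin k, Fin (x i)) c o d hod
      fun t => (load_le_iSup_load o d t).trans (by
        rw [← hχA]
        simpa using (haχ _).1 hx)
    obtain ⟨g, hg⟩ := exists_assignment_load_le (T := Σ i : Fin k, Fin (y i)) c o' d' hod'
      fun t => (load_le_iSup_load o' d' t).trans (by
        rw [← hχB]
        simpa using (hbχ _).1 hy)
    refine ⟨x, y, f, g, hxy, fun i s t => hf ⟨i, s⟩ t, fun i s t => hg ⟨i, s⟩ t, ?_⟩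
    have : Nonempty (Fin k) := ⟨⟨0, hk⟩⟩
    simp only [hM]
    exact (Finset.sup_const Finset.univ_nonempty _).symm
  · rintro m ⟨x, y, f, g, hxy, hf, hg, hm⟩
    have hle : ∀ i, x i + y i ≤ m := fun i =>
      hm ▸ Finset.le_sup (f := fun i => x i + y i) (Finset.mem_univ i)
    have hx : a ≤ ∑ i, x i := by
      rw [haχ, hχA]
      exact ciSup_le fun t => by
        simpa using load_le_mul_card c o d f t fun s => hf s.1 s.2 t
    have hy : b ≤ ∑ i, y i := by
      rw [hbχ, hχB]
      exact ciSup_le fun t => by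
        simpa using load_le_mul_card c o' d' g t fun s => hg s.1 s.2 t
    refine max_le ((Nat.add_sub_one_div_le_iff hk).2 ?_) ?_
    · calc a + b ≤ ∑ i, (x i + y i) := by
            rw [Finset.sum_add_distrib]
            exact add_le_add hx hy
        _ ≤ ∑ _i : Fin k, m := Finset.sum_le_sum fun i _ => hle i
        _ = k * m := by simp
    · have hxi : ∀ i, x i ≤ (m + 1) / 2 := fun i => by
        have h₁ := hle i
        have h₂ := (hxy i).1
        omega
      have hp : (a + k - 1) / k ≤ (m + 1) / 2 := by
        refine (Nat.add_sub_one_div_le_iff hk).2 (hx.trans ?_)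
        calc ∑ i, x i ≤ ∑ _i : Fin k, (m + 1) / 2 := Finset.sum_le_sum fun i _ => hxi i
          _ = k * ((m + 1) / 2) := by simp
      omega
end
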